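/- With f₀, h, Ω as in the context: for every integer k ≥ 2 and every w with w_k ≤ w ≤ w_{k+1}, one has mes₃{ y ∈ T³ : (w,y) ∈ Ω } ≤ π³. -/

import Mathlib

open Real MeasureTheory

noncomputable section

/-- `w_k = (27/8)·k^{3/2}`. -/
def wseq (k : ℕ) : ℝ := (27 / 8) * (k : ℝ) ^ ((3 : ℝ) / 2)

/-- The properties of the fixed cutoff function `ζ`: smooth, `ζ = 0` on `(-∞,0]`,
`ζ = 1` on `[1,∞)`, `0 ≤ ζ ≤ 1`, `ζ' > 0` on `(0,1)`, and `ζ(t) + ζ(1-t) = 1`. -/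
def IsCutoff (ζ : ℝ → ℝ) : Prop :=
  ContDiff ℝ (⊤ : ℕ∞) ζ ∧ (∀ t : ℝ, t ≤ 0 → ζ t = 0) ∧ (∀ t : ℝ, 1 ≤ t → ζ t = 1) ∧
    (∀ t : ℝ, ζ t ∈ Set.Icc (0 : ℝ) 1) ∧ (∀ t ∈ Set.Ioo (0 : ℝ) 1, 0 < deriv ζ t) ∧
    (∀ t : ℝ, ζ t + ζ (1 - t) = 1)

/-- The properties of the fixed sequence `(a_k)` in `ℤ³`:
`|a_k|² = 4k+1` and `|a_k · a_{k+1}| ≤ |a_k||a_{k+1}|/√3` for all `k ≥ 1`. -/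
def IsGoodSeq (a : ℕ → Fin 3 → ℤ) : Prop :=
  ∀ k : ℕ, 1 ≤ k →
    ((∑ i : Fin 3, (a k i) ^ 2 = 4 * (k : ℤ) + 1) ∧
      |∑ i : Fin 3, ((a k i : ℝ) * (a (k + 1) i : ℝ))| ≤
        Real.sqrt (∑ i : Fin 3, (a k i : ℝ) ^ 2) *
          Real.sqrt (∑ i : Fin 3, (a (k + 1) i : ℝ) ^ 2) / Real.sqrt 3)

/-- The function `f₀(w,y) = Σ_{k≥2} ζ((w-w_{k-1})/(w_k-w_{k-1}))·ζ((w_{k+1}-w)/(w_{k+1}-w_k))·cos(a_k·y)`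
(a locally finite sum), `2π`-periodic in each coordinate of `y`. -/
def f0 (ζ : ℝ → ℝ) (a : ℕ → Fin 3 → ℤ) (w : ℝ) (y : Fin 3 → ℝ) : ℝ :=
  ∑' k : ℕ, if 2 ≤ k then
      ζ ((w - wseq (k - 1)) / (wseq k - wseq (k - 1))) *
        ζ ((wseq (k + 1) - w) / (wseq (k + 1) - wseq k)) *
        Real.cos (∑ i : Fin 3, (a k i : ℝ) * y i)
    else 0

/-- `h = (2e)^{-10}`. -/
def hSmall : ℝ := 1 / (2 * Real.exp 1) ^ 10

/-- `Ω = {(w,y) : w ≥ w₂, |f₀(w,y)| < 2h}`, viewed as the (2π-periodic in `y`)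
subset of `ℝ × ℝ³` corresponding to a subset of `ℝ × T³`. -/
def OmegaSet (ζ : ℝ → ℝ) (a : ℕ → Fin 3 → ℤ) : Set (ℝ × (Fin 3 → ℝ)) :=
  {p | wseq 2 ≤ p.1 ∧ |f0 ζ a p.1 p.2| < 2 * hSmall}

end

noncomputable section
open Real MeasureTheory

/-- The lattice `2πℤ^ι` in `ℝ^ι`. -/
def periodLattice (ι : Type*) : AddSubgroup (ι → ℝ) :=
  (AddMonoidHom.compLeft ((AddMonoidHom.mulRight (2 * π)).comp (Int.castAddHom ℝ)) ι).range

theorem mem_periodLattice {ι : Type*} {g : ι → ℝ} :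
    g ∈ periodLattice ι ↔ ∃ n : ι → ℤ, ∀ i, g i = n i * (2 * π) := by
  simp only [periodLattice, AddMonoidHom.mem_range, funext_iff]
  exact exists_congr fun n => forall_congr' fun i => eq_comm

instance {ι : Type*} [Finite ι] : Countable (periodLattice ι) :=
  Set.countable_coe_iff.2 (Set.countable_range _)

theorem isAddFundamentalDomain_box {ι : Type*} [Fintype ι] (c : ι → ℝ) :
    IsAddFundamentalDomain (periodLattice ι)
      {y : ι → ℝ | ∀ i, y i ∈ Set.Ico (c i) (c i + 2 * π)} volume := by
  have hm : MeasurableSet {y : ι → ℝ | ∀ i, y i ∈ Set.Ico (c i) (c i + 2 * π)} := by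
    simp only [Set.ofPred_forall]
    exact MeasurableSet.iInter fun i => measurableSet_Ico.preimage (measurable_pi_apply i)
  refine IsAddFundamentalDomain.mk' hm.nullMeasurableSet fun x => ?_
  choose n hn hu using fun i => existsUnique_add_zsmul_mem_Ico Real.two_pi_pos (x i) (c i)
  refine ⟨⟨fun i => n i * (2 * π), mem_periodLattice.2 ⟨n, fun i => rfl⟩⟩, fun i => ?_, ?_⟩
  · simpa [AddSubgroup.vadd_def, add_comm] using hn i
  · rintro ⟨g, hg⟩ h
    obtain ⟨m, hm⟩ := mem_periodLattice.1 hg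
    ext i
    have := hu i (m i) (by simpa [AddSubgroup.vadd_def, add_comm, hm] using h i)
    simp [hm, this]

theorem volume_translate_inter_box {ι : Type*} [Fintype ι] {E : Set (ι → ℝ)}
    (hE : MeasurableSet E)
    (hper : ∀ g ∈ periodLattice ι, ∀ y, y + g ∈ E ↔ y ∈ E) (c v : ι → ℝ) :
    volume ({y | y + v ∈ E} ∩ {y | ∀ i, y i ∈ Set.Ico (c i) (c i + 2 * π)}) =
      volume (E ∩ {y | ∀ i, y i ∈ Set.Ico (c i) (c i + 2 * π)}) := by
  rw [(isAddFundamentalDomain_box c).measure_set_eq (isAddFundamentalDomain_box (c + v)) hE,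
    ← measure_preimage_add_right volume v (E ∩ _)]
  · congr 1
    ext y
    simp only [Set.mem_inter_iff, Set.mem_preimage, Set.mem_ofPred_eq, Pi.add_apply, Set.mem_Ico,
      add_right_comm _ (v _), add_le_add_iff_right, add_lt_add_iff_right]
  · rintro ⟨g, hg⟩
    ext y
    simpa [AddSubgroup.vadd_def, add_comm] using hper g hg y

theorem volume_mul_le_of_card_translates_le {ι : Type*} [Fintype ι] {E : Set (ι → ℝ)}
    (hE : MeasurableSet E) (hper : ∀ g ∈ periodLattice ι, ∀ y, y + g ∈ E ↔ y ∈ E)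
    (c : ι → ℝ) {N m : ℕ} (v : Fin N → ι → ℝ)
    (hcard : ∀ y, ∀ s : Finset (Fin N), (∀ j ∈ s, y + v j ∈ E) → s.card ≤ m) :
    N * volume (E ∩ {y | ∀ i, y i ∈ Set.Ico (c i) (c i + 2 * π)}) ≤
      m * volume {y : ι → ℝ | ∀ i, y i ∈ Set.Ico (c i) (c i + 2 * π)} := by
  classical
  set F := {y : ι → ℝ | ∀ i, y i ∈ Set.Ico (c i) (c i + 2 * π)}
  have hT : ∀ j, MeasurableSet {y | y + v j ∈ E} := fun j => hE.preimage (measurable_add_const _)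
  calc N * volume (E ∩ F) = ∑ j : Fin N, volume ({y | y + v j ∈ E} ∩ F) := by
        simp_rw [F, volume_translate_inter_box hE hper, Finset.sum_const, Finset.card_univ,
          Fintype.card_fin, nsmul_eq_mul]
    _ = ∑ j : Fin N, ∫⁻ y in F, {y | y + v j ∈ E}.indicator 1 y := by
        refine Finset.sum_congr rfl fun j _ => ?_
        rw [lintegral_indicator_one (hT j), Measure.restrict_apply (hT j)]
    _ = ∫⁻ y in F, ∑ j : Fin N, {y | y + v j ∈ E}.indicator 1 y :=
        (lintegral_finsetSum _ fun j _ => measurable_one.indicator (hT j)).symm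
    _ ≤ ∫⁻ _ in F, m := by
        refine lintegral_mono fun y => ?_
        have := hcard y {j | y + v j ∈ E} (by simp)
        simpa [Set.indicator_apply, Finset.sum_boole] using this
    _ = m * volume F := by simp

theorem one_eighth_le_abs_sin {x : ℝ} (h₁ : π / 16 ≤ |x|) (h₂ : |x| ≤ 15 * π / 16) :
    1 / 8 ≤ |sin x| := by
  have hπ := Real.pi_pos
  have key : ∀ t : ℝ, π / 16 ≤ t → t ≤ π / 2 → 1 / 8 ≤ sin t := fun t ht ht' => by
    refine le_trans ?_ (Real.mul_le_sin (by linarith) ht')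
    calc (1 : ℝ) / 8 = 2 / π * (π / 16) := by field_simp; norm_num
      _ ≤ 2 / π * t := by gcongr
  have hs : |sin x| = |sin (|x|)| := by
    rcases abs_choice x with h | h <;> simp [h]
  rw [hs]
  refine le_trans ?_ (le_abs_self _)
  rcases le_total |x| (π / 2) with h | h
  · exact key _ h₁ h
  · rw [← Real.sin_pi_sub]
    exact key _ (by linarith) (by linarith)

theorem one_eighth_le_abs_sin_fin {i j : Fin 16} (hij : i ≠ j) :
    1 / 8 ≤ |sin (π / 16 * ((i : ℕ) - (j : ℕ) : ℝ))| := by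
  have hd : 1 ≤ |((i : ℕ) : ℤ) - (j : ℕ)| ∧ |((i : ℕ) : ℤ) - (j : ℕ)| ≤ 15 := by
    rw [le_abs, abs_le]
    omega
  have h₁ : (1 : ℝ) ≤ |((i : ℕ) : ℝ) - (j : ℕ)| := by exact_mod_cast hd.1
  have h₂ : |((i : ℕ) : ℝ) - (j : ℕ)| ≤ 15 := by exact_mod_cast hd.2
  have hπ := Real.pi_pos
  apply one_eighth_le_abs_sin <;> rw [abs_mul, abs_of_pos (by positivity : 0 < π / 16)] <;> nlinarith

/-- Among the sixteen equidistributed angles `φ + 2πj/16`, at most two have nearly equal cosines. -/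
theorem card_le_two_of_cos_close {φ C : ℝ} {s : Finset (Fin 16)}
    (hs : ∀ j ∈ s, |cos (φ + π / 8 * (j : ℕ)) - C| < 1 / 256) : s.card ≤ 2 := by
  by_contra! h
  obtain ⟨i, hi, j, hj, l, hl, hij, hil, hjl⟩ := Finset.two_lt_card.1 h
  have key : ∀ m ∈ s, ∀ n ∈ s, m ≠ n →
      |sin (φ + π / 16 * ((m : ℕ) + (n : ℕ) : ℝ))| < 1 / 16 := fun m hm n hn hmn => by
    have h₁ : |cos (φ + π / 8 * (m : ℕ)) - cos (φ + π / 8 * (n : ℕ))| < 1 / 128 := by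
      rw [abs_lt]
      have := abs_lt.1 (hs m hm)
      have := abs_lt.1 (hs n hn)
      constructor <;> linarith
    have h₂ : cos (φ + π / 8 * (m : ℕ)) - cos (φ + π / 8 * (n : ℕ)) =
        -2 * sin (φ + π / 16 * ((m : ℕ) + (n : ℕ) : ℝ)) *
          sin (π / 16 * ((m : ℕ) - (n : ℕ) : ℝ)) := by
      rw [Real.cos_sub_cos]
      ring_nf
    rw [h₂, abs_mul, abs_mul] at h₁
    norm_num at h₁
    have h₃ := one_eighth_le_abs_sin_fin hmn
    nlinarith [abs_nonneg (sin (φ + π / 16 * ((m : ℕ) + (n : ℕ) : ℝ)))]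
  have h₁ := key i hi j hj hij
  have h₂ := key i hi l hl hil
  have h₃ := one_eighth_le_abs_sin_fin hjl
  have h₄ : π / 16 * ((j : ℕ) - (l : ℕ) : ℝ) =
      (φ + π / 16 * ((i : ℕ) + (j : ℕ) : ℝ)) - (φ + π / 16 * ((i : ℕ) + (l : ℕ) : ℝ)) := by ring
  rw [h₄, Real.sin_sub] at h₃
  generalize φ + π / 16 * ((i : ℕ) + (j : ℕ) : ℝ) = α at *
  generalize φ + π / 16 * ((i : ℕ) + (l : ℕ) : ℝ) = β at *
  have h₅ : |sin α * cos β| ≤ |sin α| := by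
    rw [abs_mul]; exact mul_le_of_le_one_right (abs_nonneg _) (abs_cos_le_one _)
  have h₆ : |cos α * sin β| ≤ |sin β| := by
    rw [abs_mul]; exact mul_le_of_le_one_left (abs_nonneg _) (abs_cos_le_one _)
  linarith [abs_sub (sin α * cos β) (cos α * sin β)]

theorem cos_dotProduct_add_period {ι : Type*} [Fintype ι] (p : ι → ℤ) (y : ι → ℝ) {g : ι → ℝ}
    (hg : g ∈ periodLattice ι) :
    cos (∑ i, (p i : ℝ) * (y + g) i) = cos (∑ i, (p i : ℝ) * y i) := by
  obtain ⟨n, hn⟩ := mem_periodLattice.1 hg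
  have : ∑ i, (p i : ℝ) * (y + g) i =
      ∑ i, (p i : ℝ) * y i + (∑ i, p i * n i : ℤ) * (2 * π) := by
    push_cast
    rw [Finset.sum_mul, ← Finset.sum_add_distrib]
    exact Finset.sum_congr rfl fun i _ => by rw [Pi.add_apply, hn]; ring
  rw [this, Real.cos_add_int_mul_two_pi]

/-- A vector orthogonal to `q` and with unit pairing with `p`. -/
theorem exists_orthogonal_unit_pairing {ι : Type*} [Fintype ι] {p q : ι → ℝ}
    (h : (∑ i, p i * q i) ^ 2 < (∑ i, p i ^ 2) * ∑ i, q i ^ 2) :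
    ∃ v : ι → ℝ, ∑ i, p i * v i = 1 ∧ ∑ i, q i * v i = 0 := by
  set S := ∑ i, p i * q i with hS
  set P := ∑ i, p i ^ 2 with hP
  set Q := ∑ i, q i ^ 2 with hQ
  have hD : P * Q - S ^ 2 ≠ 0 := by linarith
  have hsum : ∀ r : ι → ℝ, ∑ i, r i * ((Q * p i - S * q i) / (P * Q - S ^ 2)) =
      (Q * ∑ i, r i * p i - S * ∑ i, r i * q i) / (P * Q - S ^ 2) := fun r => by
    simp only [mul_sub, mul_div_assoc', Finset.mul_sum, ← Finset.sum_sub_distrib, Finset.sum_div]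
    exact Finset.sum_congr rfl fun i _ => by ring
  refine ⟨fun i => (Q * p i - S * q i) / (P * Q - S ^ 2), ?_, ?_⟩
  · rw [hsum, div_eq_one_iff_eq hD]
    simp only [← pow_two, ← hP, ← hS]
    ring
  · rw [hsum, div_eq_zero_iff]
    simp only [← pow_two, ← hQ, mul_comm (q _) (p _), ← hS]
    left
    ring

theorem volume_abs_combination_cos_lt_le {p q : Fin 3 → ℤ} {A B ε : ℝ}
    (hpq : (∑ i, (p i : ℝ) * q i) ^ 2 < (∑ i, (p i : ℝ) ^ 2) * ∑ i, (q i : ℝ) ^ 2)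
    (hA : 1 / 2 ≤ A) (hε : ε ≤ 1 / 512) :
    volume ({y : Fin 3 → ℝ | |A * cos (∑ i, (p i : ℝ) * y i) + B * cos (∑ i, (q i : ℝ) * y i)| < ε}
      ∩ {y | ∀ i, y i ∈ Set.Ico (-π) π}) ≤ ENNReal.ofReal (π ^ 3) := by
  obtain ⟨v, hpv, hqv⟩ := exists_orthogonal_unit_pairing hpq
  set E := {y : Fin 3 → ℝ |
    |A * cos (∑ i, (p i : ℝ) * y i) + B * cos (∑ i, (q i : ℝ) * y i)| < ε} with hEdef
  have hE : MeasurableSet E := measurableSet_lt (by fun_prop) measurable_const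
  have hper : ∀ g ∈ periodLattice (Fin 3), ∀ y, y + g ∈ E ↔ y ∈ E := fun g hg y => by
    simp only [hEdef, Set.mem_ofPred_eq, cos_dotProduct_add_period _ _ hg]
  have hcard : ∀ y, ∀ s : Finset (Fin 16),
      (∀ j ∈ s, y + (π / 8 * (j : ℕ)) • v ∈ E) → s.card ≤ 2 := fun y s hs => by
    refine card_le_two_of_cos_close (φ := ∑ i, (p i : ℝ) * y i)
      (C := -B * cos (∑ i, (q i : ℝ) * y i) / A) fun j hj => ?_
    have hsum : ∀ r : Fin 3 → ℤ, ∑ i, (r i : ℝ) * (y + (π / 8 * (j : ℕ)) • v) i =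
        ∑ i, (r i : ℝ) * y i + π / 8 * (j : ℕ) * ∑ i, (r i : ℝ) * v i := fun r => by
      rw [Finset.mul_sum, ← Finset.sum_add_distrib]
      exact Finset.sum_congr rfl fun i _ => by simp; ring
    have h := hs j hj
    simp only [hEdef, Set.mem_ofPred_eq, hsum, hpv, hqv, mul_one, mul_zero, add_zero] at h
    set θ := ∑ i, (p i : ℝ) * y i + π / 8 * (j : ℕ)
    set D := cos (∑ i, (q i : ℝ) * y i)
    have hA0 : A ≠ 0 := by linarith
    have heq : A * cos θ + B * D = A * (cos θ - -B * D / A) := by field_simp; ring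
    rw [heq, abs_mul, abs_of_pos (by linarith : 0 < A)] at h
    nlinarith [abs_nonneg (cos θ - -B * D / A)]
  have hbox : {y : Fin 3 → ℝ | ∀ i, y i ∈ Set.Ico (-π) (-π + 2 * π)} =
      {y | ∀ i, y i ∈ Set.Ico (-π) π} := by
    rw [show -π + 2 * π = π by ring]
  have hvol : volume {y : Fin 3 → ℝ | ∀ i, y i ∈ Set.Ico (-π) π} =
      8 * ENNReal.ofReal (π ^ 3) := by
    have : {y : Fin 3 → ℝ | ∀ i, y i ∈ Set.Ico (-π) π} =
        Set.univ.pi fun _ => Set.Ico (-π) π := by ext; simp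
    rw [this, Real.volume_pi_Ico, Finset.prod_const, Finset.card_univ, Fintype.card_fin,
      ← ENNReal.ofReal_pow (by linarith [Real.pi_pos]),
      show (π - -π) ^ 3 = 8 * π ^ 3 by ring, ENNReal.ofReal_mul (by norm_num)]
    norm_num
  have h := volume_mul_le_of_card_translates_le hE hper (fun _ => -π) _ hcard
  rw [hbox, hvol, ← mul_assoc] at h
  norm_num at h
  exact (ENNReal.mul_le_mul_iff_right (by norm_num) (by norm_num)).1 h

theorem wseq_strictMono : StrictMono wseq := fun m n h => by
  have : ((m : ℝ)) ^ ((3 : ℝ) / 2) < (n : ℝ) ^ ((3 : ℝ) / 2) :=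
    Real.rpow_lt_rpow (by positivity) (by exact_mod_cast h) (by norm_num)
  simp only [wseq]
  linarith

theorem f0_eq_of_mem_Icc {ζ : ℝ → ℝ} (hζ : IsCutoff ζ) (a : ℕ → Fin 3 → ℤ) {k : ℕ} (hk : 2 ≤ k)
    {w : ℝ} (hw1 : wseq k ≤ w) (hw2 : w ≤ wseq (k + 1)) (y : Fin 3 → ℝ) :
    f0 ζ a w y =
      (1 - ζ ((w - wseq k) / (wseq (k + 1) - wseq k))) * cos (∑ i, (a k i : ℝ) * y i) +
        ζ ((w - wseq k) / (wseq (k + 1) - wseq k)) * cos (∑ i, (a (k + 1) i : ℝ) * y i) := by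
  obtain ⟨-, h0, h1, -, -, hsymm⟩ := hζ
  have hlt : ∀ m, 0 < wseq (m + 1) - wseq m := fun m =>
    sub_pos.2 (wseq_strictMono m.lt_succ_self)
  rw [f0, tsum_eq_sum (s := {k, k + 1}), Finset.sum_pair (by omega), if_pos hk,
    if_pos (by omega)]
  · obtain ⟨m, rfl⟩ : ∃ m, k = m + 1 := ⟨k - 1, by omega⟩
    simp only [Nat.add_sub_cancel]
    rw [h1 ((w - wseq m) / _) ((one_le_div (hlt m)).2 (by linarith)),
      h1 ((wseq (m + 1 + 1 + 1) - w) / _) ((one_le_div (hlt _)).2 (by linarith)),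
      show (wseq (m + 1 + 1) - w) / (wseq (m + 1 + 1) - wseq (m + 1)) =
        1 - (w - wseq (m + 1)) / (wseq (m + 1 + 1) - wseq (m + 1)) by
          have := (hlt (m + 1)).ne'
          field_simp
          ring,
      eq_sub_of_add_eq' (hsymm ((w - wseq (m + 1)) / (wseq (m + 1 + 1) - wseq (m + 1))))]
    ring
  · intro j hj
    simp only [Finset.mem_insert, Finset.mem_singleton, not_or] at hj
    split_ifs with hj2
    · obtain ⟨m, rfl⟩ : ∃ m, j = m + 1 := ⟨j - 1, by omega⟩
      simp only [Nat.add_sub_cancel]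
      rcases lt_or_ge (m + 1) k with h | h
      · have := wseq_strictMono.monotone (show m + 1 + 1 ≤ k by omega)
        rw [h0 ((wseq (m + 1 + 1) - w) / _)
          (div_nonpos_of_nonpos_of_nonneg (by linarith) (hlt _).le)]
        ring
      · have := wseq_strictMono.monotone (show k + 1 ≤ m by omega)
        rw [h0 ((w - wseq m) / _) (div_nonpos_of_nonpos_of_nonneg (by linarith) (hlt _).le)]
        ring
    · rfl

theorem two_mul_hSmall_le : 2 * hSmall ≤ 1 / 512 := by
  have he : (1 : ℝ) ≤ exp 1 := Real.one_le_exp (by norm_num)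
  have h : (2 : ℝ) ^ 10 ≤ (2 * exp 1) ^ 10 := by
    gcongr
    linarith
  have := one_div_le_one_div_of_le (by norm_num) h
  rw [hSmall]
  linarith

theorem IsGoodSeq.sq_dotProduct_lt {a : ℕ → Fin 3 → ℤ} (ha : IsGoodSeq a) {k : ℕ} (hk : 1 ≤ k) :
    (∑ i, (a k i : ℝ) * a (k + 1) i) ^ 2 <
      (∑ i, (a k i : ℝ) ^ 2) * ∑ i, (a (k + 1) i : ℝ) ^ 2 := by
  have hpos : ∀ m, 1 ≤ m → 0 < ∑ i, (a m i : ℝ) ^ 2 := fun m hm => by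
    have h : ∑ i, (a m i : ℝ) ^ 2 = 4 * (m : ℝ) + 1 := by exact_mod_cast (ha m hm).1
    rw [h]
    positivity
  have hP := hpos k hk
  have hQ := hpos (k + 1) (by omega)
  have h := pow_le_pow_left₀ (abs_nonneg _) (ha k hk).2 2
  rw [sq_abs, div_pow, mul_pow, Real.sq_sqrt hP.le, Real.sq_sqrt hQ.le,
    Real.sq_sqrt (by norm_num)] at h
  have := mul_pos hP hQ
  linarith

/-- **Lemma 2.8.** For every `k ≥ 2` and `w_k ≤ w ≤ w_{k+1}`,
`mes₃{y ∈ T³ : (w,y) ∈ Ω} ≤ π³` (the measure on `T³` computed on the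
fundamental domain `[-π,π)³`). -/
theorem statement13 (ζ : ℝ → ℝ) (hζ : IsCutoff ζ) (a : ℕ → Fin 3 → ℤ) (ha : IsGoodSeq a)
    (k : ℕ) (hk : 2 ≤ k) (w : ℝ) (hw1 : wseq k ≤ w) (hw2 : w ≤ wseq (k + 1)) :
    volume {y : Fin 3 → ℝ | (∀ i, y i ∈ Set.Ico (-π) π) ∧ (w, y) ∈ OmegaSet ζ a} ≤
      ENNReal.ofReal (π ^ 3) := by
  have hset : {y : Fin 3 → ℝ | (∀ i, y i ∈ Set.Ico (-π) π) ∧ (w, y) ∈ OmegaSet ζ a} ⊆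
      {y | |(1 - ζ ((w - wseq k) / (wseq (k + 1) - wseq k))) * cos (∑ i, (a k i : ℝ) * y i) +
        ζ ((w - wseq k) / (wseq (k + 1) - wseq k)) * cos (∑ i, (a (k + 1) i : ℝ) * y i)| <
          2 * hSmall} ∩ {y | ∀ i, y i ∈ Set.Ico (-π) π} := by
    rintro y ⟨hy, -, hlt⟩
    rw [f0_eq_of_mem_Icc hζ a hk hw1 hw2] at hlt
    exact ⟨hlt, hy⟩
  refine (measure_mono hset).trans ?_
  have hgram := ha.sq_dotProduct_lt (show 1 ≤ k by omega)
  rcases le_total (ζ ((w - wseq k) / (wseq (k + 1) - wseq k))) (1 / 2) with h | h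
  · exact volume_abs_combination_cos_lt_le hgram (by linarith) two_mul_hSmall_le
  · simp_rw [add_comm ((1 - ζ _) * _)]
    refine volume_abs_combination_cos_lt_le ?_ h two_mul_hSmall_le
    simpa only [mul_comm] using hgram

end
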